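/- Let G be a group, let m ≥ 1 be a natural number, let R ∈ G satisfy R^2 = 1 and R * y_i * R⁻¹ = y_i⁻¹ for elements y_1, …, y_{2m} ∈ G, and suppose that R = y_{2m} * y_{2m-1} * ⋯ * y_1. Then R lies in the subgroup of G generated by the 2m elements {R * y_{2k}⁻¹ : 1 ≤ k ≤ m} ∪ {R * y_{2k-1} : 1 ≤ k ≤ m}. -/

import Mathlib

/-- A descending product of evenly many factors lies in any submonoid that contains the products
of its consecutive pairs of factors. -/
theorem Submonoid.prod_reverse_range_two_mul_mem {M : Type*} [Monoid M] (S : Submonoid M)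
    (y : ℕ → M) (n : ℕ) (h : ∀ k < n, y (2 * k + 1) * y (2 * k) ∈ S) :
    ((List.range (2 * n)).reverse.map y).prod ∈ S := by
  induction n with
  | zero => simp
  | succ n ih =>
    have hS := S.mul_mem (h n n.lt_succ_self) (ih fun k hk => h k (hk.trans n.lt_succ_self))
    simpa [Nat.mul_succ, List.range_succ, mul_assoc] using hS

theorem reflection_in_closure_of_alternating_involutions
    {G : Type*} [Group G] (m : ℕ) (hm : 1 ≤ m) (R : G) (y : ℕ → G)
    (hR : R ^ 2 = 1)
    (hy : ∀ i, 1 ≤ i → i ≤ 2 * m → R * y i * R⁻¹ = (y i)⁻¹)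
    (hprod : R = (((List.range (2 * m)).reverse.map (fun i => y (i + 1))).prod)) :
    R ∈ Subgroup.closure
      (((fun k => R * (y (2 * k))⁻¹) '' {k | 1 ≤ k ∧ k ≤ m}) ∪
        ((fun k => R * y (2 * k - 1)) '' {k | 1 ≤ k ∧ k ≤ m})) := by
  rw [hprod]
  refine Submonoid.prod_reverse_range_two_mul_mem (Subgroup.closure _).toSubmonoid
    (fun i => y (i + 1)) m fun k hk => ?_
  rw [← hprod]
  have hinv : R * (y (2 * k + 2))⁻¹ = y (2 * k + 2) * R := by
    rw [← hy (2 * k + 2) (by omega) (by omega)]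
    have hRinv : R⁻¹ = R := inv_eq_of_mul_eq_one_left (by rw [← sq, hR])
    rw [hRinv, ← mul_assoc, ← mul_assoc, ← sq, hR, one_mul]
  have hpair : y (2 * k + 2) * y (2 * k + 1) =
      R * (y (2 * k + 2))⁻¹ * (R * y (2 * k + 1)) := by
    rw [hinv, mul_assoc, ← mul_assoc R, ← sq, hR, one_mul]
  change y (2 * k + 2) * y (2 * k + 1) ∈ Subgroup.closure _
  rw [hpair]
  exact mul_mem
    (Subgroup.subset_closure (Or.inl ⟨k + 1, ⟨by omega, by omega⟩, rfl⟩))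
    (Subgroup.subset_closure (Or.inr ⟨k + 1, ⟨by omega, by omega⟩, rfl⟩))
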